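/- For any positive integer K and any τ ∈ [0,1], the minimax excess risk over the group-covariate shift class P_GS(τ) is at least (1/(64K))·exp( −(n_min·(2−τ) + n_maj·τ)/(3K³) ). -/

import Mathlib

open MeasureTheory Set
open scoped ENNReal Classical

noncomputable section

/-! ## Basic setup: distributions on `ℝ × Bool`, risk, excess risk.

A labelled example is a pair `(x, y) : ℝ × Bool`, where the label `true` codes `+1`
and `false` codes `-1`; features are supported on `[0,1]`. -/

/-- The risk (probability of misclassification) of a classifier `f : ℝ → Bool`
under a distribution `P` on `ℝ × Bool`. -/
def risk (f : ℝ → Bool) (P : Measure (ℝ × Bool)) : ℝ :=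
  (P {p : ℝ × Bool | f p.1 ≠ p.2}).toReal

/-- The Bayes risk of a distribution: the infimum of the risk over all classifiers. -/
def bayesRisk (P : Measure (ℝ × Bool)) : ℝ :=
  ⨅ f : ℝ → Bool, risk f P

/-- The balanced test distribution `P_test = (1/2) P_maj + (1/2) P_min`. -/
def testMeasure (Pmaj Pmin : Measure (ℝ × Bool)) : Measure (ℝ × Bool) :=
  (2 : ℝ≥0∞)⁻¹ • Pmaj + (2 : ℝ≥0∞)⁻¹ • Pmin

/-- A training sample: `nmaj` labelled points from the majority distribution and
`nmin` labelled points from the minority distribution. -/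
abbrev Sample (nmaj nmin : ℕ) : Type :=
  (Fin nmaj → ℝ × Bool) × (Fin nmin → ℝ × Bool)

/-- The law `P_maj^{n_maj} × P_min^{n_min}` of the training sample. -/
def sampleMeasure (nmaj nmin : ℕ) (Pmaj Pmin : Measure (ℝ × Bool)) :
    Measure (Sample nmaj nmin) :=
  (Measure.pi fun _ : Fin nmaj => Pmaj).prod (Measure.pi fun _ : Fin nmin => Pmin)

/-- An algorithm (a map from samples to classifiers) is measurable if the joint map
`(S, x) ↦ A S x` is measurable. -/
def MeasurableAlg (nmaj nmin : ℕ) (A : Sample nmaj nmin → ℝ → Bool) : Prop :=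
  Measurable fun p : Sample nmaj nmin × ℝ => A p.1 p.2

/-- The expected excess risk of the algorithm `A` on the pair `(P_maj, P_min)`:
`E_{S ~ P_maj^{n_maj} × P_min^{n_min}}[R(A^S; P_test)] - R(f^*; P_test)`. -/
def excessRisk (nmaj nmin : ℕ) (A : Sample nmaj nmin → ℝ → Bool)
    (Pmaj Pmin : Measure (ℝ × Bool)) : ℝ :=
  (∫ S, risk (A S) (testMeasure Pmaj Pmin) ∂sampleMeasure nmaj nmin Pmaj Pmin)
    - bayesRisk (testMeasure Pmaj Pmin)

/-- The distribution on `ℝ × Bool` supported on label `y` whose feature has density `p`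
(w.r.t. Lebesgue measure) on `[0,1]`. -/
def labelMeasure (p : ℝ → ℝ) (y : Bool) : Measure (ℝ × Bool) :=
  Measure.map (fun x => (x, y))
    ((volume.restrict (Icc (0:ℝ) 1)).withDensity fun x => ENNReal.ofReal (p x))

/-- The label-shift class `𝒫_LS`: `P_maj(x,y) = P₁(x)·1{y = 1}`,
`P_min(x,y) = P₋₁(x)·1{y = -1}` with `P₁, P₋₁` 1-Lipschitz densities on `[0,1]`. -/
def memLS (Pmaj Pmin : Measure (ℝ × Bool)) : Prop :=
  ∃ p1 pm1 : ℝ → ℝ,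
    (∀ x, 0 ≤ p1 x) ∧ (∀ x, 0 ≤ pm1 x) ∧
    LipschitzOnWith 1 p1 (Icc 0 1) ∧ LipschitzOnWith 1 pm1 (Icc 0 1) ∧
    (∫ x in Icc (0:ℝ) 1, p1 x) = 1 ∧ (∫ x in Icc (0:ℝ) 1, pm1 x) = 1 ∧
    Pmaj = labelMeasure p1 true ∧ Pmin = labelMeasure pm1 false

/-- Total variation distance between two densities on `[0,1]`:
`TV(p, q) = (1/2)∫₀¹ |p - q|`. -/
def tvDist (p q : ℝ → ℝ) : ℝ :=
  (1/2) * ∫ x in Icc (0:ℝ) 1, |p x - q x|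

/-- The distribution on `ℝ × Bool` whose feature has density `p` on `[0,1]` and whose
label is `true` with probability `η x` conditionally on the feature `x`. -/
def covMeasure (p η : ℝ → ℝ) : Measure (ℝ × Bool) :=
  labelMeasure (fun x => p x * η x) true + labelMeasure (fun x => p x * (1 - η x)) false

/-- The group-covariate shift class `𝒫_GS(τ)`: `P_maj(x,y) = P_a(x)·P(y|x)`,
`P_min(x,y) = P_b(x)·P(y|x)` with group densities `P_a, P_b` on `[0,1]`,
a shared 1-Lipschitz conditional label distribution, and overlap
`1 - TV(P_a, P_b) ≥ τ`. -/
def memGS (τ : ℝ) (Pmaj Pmin : Measure (ℝ × Bool)) : Prop :=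
  ∃ pa pb η : ℝ → ℝ,
    (∀ x, 0 ≤ pa x) ∧ (∀ x, 0 ≤ pb x) ∧
    (∫ x in Icc (0:ℝ) 1, pa x) = 1 ∧ (∫ x in Icc (0:ℝ) 1, pb x) = 1 ∧
    (∀ x, 0 ≤ η x ∧ η x ≤ 1) ∧
    LipschitzOnWith 1 η (Icc 0 1) ∧ LipschitzOnWith 1 (fun x => 1 - η x) (Icc 0 1) ∧
    τ ≤ 1 - tvDist pa pb ∧
    Pmaj = covMeasure pa η ∧ Pmin = covMeasure pb η

/-! ## The hat function -/

/-- The hat function `φ_K`. -/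
def hatFun (K : ℕ) (x : ℝ) : ℝ :=
  if x ∈ Icc (-(1/(2*(K:ℝ)))) 0 then |x + 1/(4*(K:ℝ))| - 1/(4*(K:ℝ))
  else if x ∈ Icc (0:ℝ) (1/(2*(K:ℝ))) then 1/(4*(K:ℝ)) - |x - 1/(4*(K:ℝ))|
  else 0

/-! ## The hard family for the label-shift lower bound.

Bins are 0-indexed: `I_j = [j/K, (j+1)/K)` for `j = 0, …, K-1`, corresponding to the
paper's `I_{j+1} = [((j+1)-1)/K, (j+1)/K]`; the bin center is `(j + 1/2)/K`. -/

/-- The value in `{-1, 0, 1}` coded by an element of `Fin 3`. -/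
def trit (i : Fin 3) : ℝ := (i : ℝ) - 1

/-- The perturbed density of the hard label-shift family: on the bin
`I_j = [j/K, (j+1)/K)` it equals `1 + v_j · φ_K(x - (j + 1/2)/K)`. -/
def hardDensityLS (K : ℕ) (v : Fin K → Fin 3) (x : ℝ) : ℝ :=
  1 + ∑ j : Fin K,
    (if x ∈ Ico ((j:ℝ)/(K:ℝ)) (((j:ℝ)+1)/(K:ℝ))
      then trit (v j) * hatFun K (x - ((j:ℝ) + 1/2)/(K:ℝ)) else 0)

/-- The index set `𝒱 = {-1,0,1}^K × {-1,0,1}^K` of the hard label-shift family. -/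
abbrev TritPair (K : ℕ) : Type := (Fin K → Fin 3) × (Fin K → Fin 3)

/-- The law `Q(S | v) = P_{v,maj}^{n_maj} × P_{v,min}^{n_min}` of the sample for the hard
label-shift instance indexed by `v`. -/
def hardLSMeasure (K nmaj nmin : ℕ) (v : TritPair K) : Measure (Sample nmaj nmin) :=
  sampleMeasure nmaj nmin (labelMeasure (hardDensityLS K v.1) true)
    (labelMeasure (hardDensityLS K v.2) false)

/-- The marginal law `Q_S` of the sample when the index `V` is uniform on `𝒱`. -/
def hardLSMarginal (K nmaj nmin : ℕ) : Measure (Sample nmaj nmin) :=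
  ∑ v : TritPair K, (Fintype.card (TritPair K) : ℝ≥0∞)⁻¹ • hardLSMeasure K nmaj nmin v

/-- The posterior weight `Q(v | S)`: the Radon–Nikodym derivative of
`(1/|𝒱|) · Q(S | v)` with respect to `Q_S`, evaluated at `S`. -/
def postLS (K nmaj nmin : ℕ) (v : TritPair K) (S : Sample nmaj nmin) : ℝ :=
  (((Fintype.card (TritPair K) : ℝ≥0∞)⁻¹ • hardLSMeasure K nmaj nmin v).rnDeriv
      (hardLSMarginal K nmaj nmin) S).toReal

/-- The posterior mixture density `Σ_{v ∈ 𝒱} Q(v | S) · P_{v, ±1}`;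
`cls = true` selects the class `+1` densities `P_{v,1}`. -/
def postMixLS (K nmaj nmin : ℕ) (S : Sample nmaj nmin) (cls : Bool) (x : ℝ) : ℝ :=
  ∑ v : TritPair K,
    postLS K nmaj nmin v S * hardDensityLS K (if cls then v.1 else v.2) x

/-! ## The hard family for the group-covariate shift lower bound -/

/-- The sign `+1` / `-1` coded by a Bool. -/
def sgnB (b : Bool) : ℝ := if b then 1 else -1

/-- `P_v(y = 1 | x)` for the hard group-shift family: on the bin `I_j = [j/K, (j+1)/K)` it
equals `(1/2)(1 + v_j · φ_K(x - (j+1/2)/K))`. -/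
def hardEta (K : ℕ) (v : Fin K → Bool) (x : ℝ) : ℝ :=
  (1/2) * (1 + ∑ j : Fin K,
    (if x ∈ Ico ((j:ℝ)/(K:ℝ)) (((j:ℝ)+1)/(K:ℝ))
      then sgnB (v j) * hatFun K (x - ((j:ℝ) + 1/2)/(K:ℝ)) else 0))

/-- The majority-group feature density: `2 - τ` on `[0, 1/2)` and `τ` on `[1/2, 1]`. -/
def hardPa (τ : ℝ) (x : ℝ) : ℝ := if x < 1/2 then 2 - τ else τ

/-- The minority-group feature density `P_b = 2 - P_a`. -/
def hardPb (τ : ℝ) (x : ℝ) : ℝ := 2 - hardPa τ x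

/-- The law `Q(S | v)` of the sample for the hard group-shift instance indexed by `v`. -/
def hardGSMeasure (K nmaj nmin : ℕ) (τ : ℝ) (v : Fin K → Bool) :
    Measure (Sample nmaj nmin) :=
  sampleMeasure nmaj nmin (covMeasure (hardPa τ) (hardEta K v))
    (covMeasure (hardPb τ) (hardEta K v))

/-- The conditional law `Q(S | v_j = b)` of the sample given the `j`-th coordinate of the
uniformly random index: the uniform mixture over all `v` with `v_j = b`. -/
def condGS (K nmaj nmin : ℕ) (τ : ℝ) (j : Fin K) (b : Bool) :
    Measure (Sample nmaj nmin) :=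
  ((Finset.univ.filter fun v : Fin K → Bool => v j = b).card : ℝ≥0∞)⁻¹ •
    ∑ v ∈ Finset.univ.filter (fun v : Fin K → Bool => v j = b),
      hardGSMeasure K nmaj nmin τ v

/-- The Kullback–Leibler divergence `KL(μ ‖ ν) = ∫ log (dμ/dν) dμ`. -/
def klDiv' {α : Type*} [MeasurableSpace α] (μ ν : Measure α) : ℝ :=
  ∫ x, Real.log ((μ.rnDeriv ν x).toReal) ∂μ

/-! ## The undersampled binning estimator -/

/-- The prediction of the undersampled binning estimator on the bin `I_j = [j/K, (j+1)/K)`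
(0-indexed), where `s ⊆ Fin nmaj` is the set of retained majority samples: predict `+1`
iff the samples of the undersampled dataset in the bin with label `+1` strictly
outnumber those with label `-1`. -/
def usbBinPred (nmaj nmin K : ℕ) (s : Finset (Fin nmaj)) (S : Sample nmaj nmin)
    (j : ℕ) : Bool :=
  decide
    ((s.filter fun i => (S.1 i).2 = false ∧
        (S.1 i).1 ∈ Ico ((j:ℝ)/(K:ℝ)) (((j:ℝ)+1)/(K:ℝ))).card +
      (Finset.univ.filter fun i : Fin nmin => (S.2 i).2 = false ∧
        (S.2 i).1 ∈ Ico ((j:ℝ)/(K:ℝ)) (((j:ℝ)+1)/(K:ℝ))).card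
      <
      (s.filter fun i => (S.1 i).2 = true ∧
        (S.1 i).1 ∈ Ico ((j:ℝ)/(K:ℝ)) (((j:ℝ)+1)/(K:ℝ))).card +
      (Finset.univ.filter fun i : Fin nmin => (S.2 i).2 = true ∧
        (S.2 i).1 ∈ Ico ((j:ℝ)/(K:ℝ)) (((j:ℝ)+1)/(K:ℝ))).card)

/-- The undersampled binning classifier `A_USB^{S,K}` with `K` bins, given the retained
majority samples `s`: on each bin it predicts the majority label among the undersampled
data in that bin. -/
def usbClassifier (nmaj nmin K : ℕ) (s : Finset (Fin nmaj)) (S : Sample nmaj nmin) :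
    ℝ → Bool :=
  fun x => usbBinPred nmaj nmin K s S (min ⌊x * (K:ℝ)⌋₊ (K - 1))

/-- The expected excess risk of the undersampled binning estimator with `K` bins, where the
`nmin` retained majority samples are drawn uniformly at random without replacement
(uniformly among all subsets of size `nmin`). -/
def usbExcessRisk (nmaj nmin K : ℕ) (Pmaj Pmin : Measure (ℝ × Bool)) : ℝ :=
  (∑ s ∈ Finset.powersetCard nmin (Finset.univ : Finset (Fin nmaj)),
      ∫ S, risk (usbClassifier nmaj nmin K s S) (testMeasure Pmaj Pmin)
        ∂sampleMeasure nmaj nmin Pmaj Pmin)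
    / ((Finset.powersetCard nmin (Finset.univ : Finset (Fin nmaj))).card : ℝ)
  - bayesRisk (testMeasure Pmaj Pmin)

/-- `q_{j,y} = P(y | x ∈ I_j)` for the 0-indexed bin `I_j = [j/K, (j+1)/K)`. -/
def qBin (P : Measure (ℝ × Bool)) (K j : ℕ) (y : Bool) : ℝ :=
  (P ((Ico ((j:ℝ)/(K:ℝ)) (((j:ℝ)+1)/(K:ℝ))) ×ˢ ({y} : Set Bool))).toReal /
    (P ((Ico ((j:ℝ)/(K:ℝ)) (((j:ℝ)+1)/(K:ℝ))) ×ˢ (univ : Set Bool))).toReal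

/-- The excess risk of the binning estimator in the bin `I_j`:
`R_j(A_USB^S) = q_{j, -A_j^S} - min{q_{j,1}, q_{j,-1}}`. -/
def binExcess (nmaj nmin K : ℕ) (s : Finset (Fin nmaj)) (S : Sample nmaj nmin)
    (P : Measure (ℝ × Bool)) (j : ℕ) : ℝ :=
  qBin P K j (!(usbBinPred nmaj nmin K s S j)) - min (qBin P K j true) (qBin P K j false)

/-- The binomial probability mass function `P[Bin(m, p) = k]`. -/
def binomPMF (m : ℕ) (p : ℝ) (k : ℕ) : ℝ :=
  (m.choose k : ℝ) * p ^ k * (1 - p) ^ (m - k)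

/-! ## Measures dominated by a geometric mean -/

section GeomMean

variable {α β : Type*} [MeasurableSpace α] [MeasurableSpace β]

/-- `M` is dominated by the geometric mean of `P` and `Q`, expressed as a Cauchy–Schwarz
inequality for pairs of test functions. -/
def LeGeomMean (M P Q : Measure α) : Prop :=
  ∀ f g : α → ℝ≥0∞, Measurable f → Measurable g →
    ∫⁻ x, f x * g x ∂M ≤
      (∫⁻ x, f x ^ (2:ℝ) ∂P) ^ (1/2:ℝ) * (∫⁻ x, g x ^ (2:ℝ) ∂Q) ^ (1/2:ℝ)

lemma LeGeomMean.refl (M : Measure α) : LeGeomMean M M M := fun _ _ hf hg =>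
  ENNReal.lintegral_mul_le_Lp_mul_Lq M Real.HolderConjugate.two_two hf.aemeasurable
    hg.aemeasurable

lemma LeGeomMean.withDensity (ν : Measure α) {m p q : α → ℝ≥0∞} (hm : Measurable m)
    (hp : Measurable p) (hq : Measurable q)
    (h : ∀ x, m x ≤ p x ^ (1/2:ℝ) * q x ^ (1/2:ℝ)) :
    LeGeomMean (ν.withDensity m) (ν.withDensity p) (ν.withDensity q) := by
  intro f g hf hg
  have key := LeGeomMean.refl ν (fun x => p x ^ (1/2:ℝ) * f x) (fun x => q x ^ (1/2:ℝ) * g x)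
    ((hp.pow_const _).mul hf) ((hq.pow_const _).mul hg)
  have hsq : ∀ a b : ℝ≥0∞, (a ^ (1/2:ℝ) * b) ^ (2:ℝ) = a * b ^ (2:ℝ) := fun a b => by
    rw [ENNReal.mul_rpow_of_nonneg _ _ zero_le_two, ← ENNReal.rpow_mul]
    norm_num
  simp only [hsq] at key
  have hfg : Measurable fun x => f x * g x := hf.mul hg
  rw [lintegral_withDensity_eq_lintegral_mul _ hm hfg,
    lintegral_withDensity_eq_lintegral_mul _ hp (hf.pow_const _),
    lintegral_withDensity_eq_lintegral_mul _ hq (hg.pow_const _)]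
  refine le_trans (lintegral_mono fun x => ?_) key
  calc m x * (f x * g x) ≤ (p x ^ (1/2:ℝ) * q x ^ (1/2:ℝ)) * (f x * g x) := by gcongr; exact h x
    _ = _ := by ring

lemma LeGeomMean.map {M P Q : Measure α} (h : LeGeomMean M P Q) {φ : α → β}
    (hφ : Measurable φ) : LeGeomMean (M.map φ) (P.map φ) (Q.map φ) := by
  intro f g hf hg
  have hfg : Measurable fun x => f x * g x := hf.mul hg
  rw [lintegral_map hfg hφ, lintegral_map (hf.pow_const _) hφ,
    lintegral_map (hg.pow_const _) hφ]
  exact h _ _ (hf.comp hφ) (hg.comp hφ)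

lemma sqrt_mul_add_sqrt_mul_le (a b c d : ℝ≥0∞) :
    a ^ (1/2:ℝ) * b ^ (1/2:ℝ) + c ^ (1/2:ℝ) * d ^ (1/2:ℝ) ≤
      (a + c) ^ (1/2:ℝ) * (b + d) ^ (1/2:ℝ) := by
  have h := ENNReal.inner_le_Lp_mul_Lq (Finset.univ : Finset (Fin 2))
    ![a ^ (1/2:ℝ), c ^ (1/2:ℝ)] ![b ^ (1/2:ℝ), d ^ (1/2:ℝ)] Real.HolderConjugate.two_two
  have hsq : ∀ a : ℝ≥0∞, (a ^ (1/2:ℝ)) ^ (2:ℝ) = a := fun a => by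
    rw [← ENNReal.rpow_mul]; norm_num
  simpa only [Fin.sum_univ_two, Matrix.cons_val_zero, Matrix.cons_val_one, hsq] using h

lemma LeGeomMean.add {M P Q M' P' Q' : Measure α} (h : LeGeomMean M P Q)
    (h' : LeGeomMean M' P' Q') : LeGeomMean (M + M') (P + P') (Q + Q') := by
  intro f g hf hg
  simp only [lintegral_add_measure]
  exact (add_le_add (h f g hf hg) (h' f g hf hg)).trans (sqrt_mul_add_sqrt_mul_le _ _ _ _)

lemma LeGeomMean.prod {M P Q : Measure α} {M' P' Q' : Measure β} [SFinite M'] [SFinite P']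
    [SFinite Q'] (h : LeGeomMean M P Q) (h' : LeGeomMean M' P' Q') :
    LeGeomMean (M.prod M') (P.prod P') (Q.prod Q') := by
  intro f g hf hg
  have hfg : Measurable fun x => f x * g x := hf.mul hg
  rw [lintegral_prod _ hfg.aemeasurable, lintegral_prod _ (hf.pow_const _).aemeasurable,
    lintegral_prod _ (hg.pow_const _).aemeasurable]
  have hsq : ∀ a : ℝ≥0∞, (a ^ (1/2:ℝ)) ^ (2:ℝ) = a := fun a => by
    rw [← ENNReal.rpow_mul]; norm_num
  refine (lintegral_mono fun x => h' (fun y => f (x, y)) (fun y => g (x, y))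
    (hf.comp measurable_prodMk_left) (hg.comp measurable_prodMk_left)).trans ?_
  have key := h (fun x => (∫⁻ y, f (x, y) ^ (2:ℝ) ∂P') ^ (1/2:ℝ))
    (fun x => (∫⁻ y, g (x, y) ^ (2:ℝ) ∂Q') ^ (1/2:ℝ))
    ((hf.pow_const _).lintegral_prod_right'.pow_const _)
    ((hg.pow_const _).lintegral_prod_right'.pow_const _)
  simpa only [hsq] using key

lemma LeGeomMean.pi {M P Q : Measure α} [SigmaFinite M] [SigmaFinite P] [SigmaFinite Q]
    (h : LeGeomMean M P Q) (n : ℕ) :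
    LeGeomMean (Measure.pi fun _ : Fin n => M) (Measure.pi fun _ : Fin n => P)
      (Measure.pi fun _ : Fin n => Q) := by
  induction n with
  | zero =>
    rw [Measure.pi_of_empty, Measure.pi_of_empty, Measure.pi_of_empty]
    exact LeGeomMean.refl _
  | succ n ih =>
    have e (μ : Measure α) [SigmaFinite μ] :=
      (measurePreserving_piFinSuccAbove (fun _ : Fin (n+1) => μ) 0).symm.map_eq
    rw [← e M, ← e P, ← e Q]
    exact (h.prod ih).map (MeasurableEquiv.measurable _)

lemma LeGeomMean.sq_measure_univ_le {M P Q : Measure α} [IsProbabilityMeasure P]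
    [IsProbabilityMeasure Q] (h : LeGeomMean M P Q) {E : Set α} (hE : MeasurableSet E) :
    M.real univ ^ 2 ≤ 2 * (P.real E + Q.real Eᶜ) := by
  have hset : ∀ F : Set α, MeasurableSet F → M F ≤ P F ^ (1/2:ℝ) * Q F ^ (1/2:ℝ) := by
    intro F hF
    have := h (F.indicator 1) (F.indicator 1) (measurable_one.indicator hF)
      (measurable_one.indicator hF)
    have e1 : ∀ x, F.indicator (1 : α → ℝ≥0∞) x ^ (2:ℝ) = F.indicator 1 x := fun x => by
      by_cases hx : x ∈ F <;> simp [hx]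
    have e2 : ∀ x, F.indicator (1 : α → ℝ≥0∞) x * F.indicator 1 x = F.indicator 1 x := fun x => by
      by_cases hx : x ∈ F <;> simp [hx]
    simpa only [e1, e2, lintegral_indicator_one hF] using this
  have h1 : M E ≤ P E ^ (1/2:ℝ) := (hset E hE).trans <| by
    calc P E ^ (1/2:ℝ) * Q E ^ (1/2:ℝ) ≤ P E ^ (1/2:ℝ) * 1 := by
          gcongr; exact ENNReal.rpow_le_one prob_le_one (by norm_num)
      _ = _ := mul_one _
  have h2 : M Eᶜ ≤ Q Eᶜ ^ (1/2:ℝ) := (hset Eᶜ hE.compl).trans <| by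
    calc P Eᶜ ^ (1/2:ℝ) * Q Eᶜ ^ (1/2:ℝ) ≤ 1 * Q Eᶜ ^ (1/2:ℝ) := by
          gcongr; exact ENNReal.rpow_le_one prob_le_one (by norm_num)
      _ = _ := one_mul _
  have fin : ∀ {μ : Measure α} [IsProbabilityMeasure μ] (F : Set α), μ F ^ (1/2:ℝ) ≠ ∞ :=
    fun F => ENNReal.rpow_ne_top_of_nonneg (by norm_num) (measure_ne_top _ _)
  have r1 : M.real E ≤ √(P.real E) := by
    have := ENNReal.toReal_mono (fin E) h1
    rwa [← ENNReal.toReal_rpow, ← Real.sqrt_eq_rpow] at this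
  have r2 : M.real Eᶜ ≤ √(Q.real Eᶜ) := by
    have := ENNReal.toReal_mono (fin Eᶜ) h2
    rwa [← ENNReal.toReal_rpow, ← Real.sqrt_eq_rpow] at this
  have hsum : M.real univ = M.real E + M.real Eᶜ := by
    simp only [measureReal_def]
    rw [← measure_add_measure_compl hE, ENNReal.toReal_add (ne_top_of_le_ne_top (fin E) h1)
      (ne_top_of_le_ne_top (fin Eᶜ) h2)]
  have s1 : √(P.real E) ^ 2 = P.real E := Real.sq_sqrt measureReal_nonneg
  have s2 : √(Q.real Eᶜ) ^ 2 = Q.real Eᶜ := Real.sq_sqrt measureReal_nonneg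
  have m1 : 0 ≤ M.real E := measureReal_nonneg
  have m2 : 0 ≤ M.real Eᶜ := measureReal_nonneg
  calc M.real univ ^ 2 ≤ (√(P.real E) + √(Q.real Eᶜ)) ^ 2 := by rw [hsum]; gcongr
    _ ≤ 2 * (√(P.real E) ^ 2 + √(Q.real Eᶜ) ^ 2) := add_sq_le
    _ = _ := by rw [s1, s2]

end GeomMean

/-! ## Labelled distributions on the unit interval -/

section Labelled

lemma lintegral_labelMeasure {p : ℝ → ℝ} (hp : Measurable p) (y : Bool) {f : ℝ × Bool → ℝ≥0∞}
    (hf : Measurable f) :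
    ∫⁻ z, f z ∂labelMeasure p y = ∫⁻ x in Icc (0:ℝ) 1, ENNReal.ofReal (p x) * f (x, y) := by
  unfold labelMeasure
  have hfy : Measurable fun x => f (x, y) := hf.comp measurable_prodMk_right
  rw [lintegral_map hf measurable_prodMk_right, lintegral_withDensity_eq_lintegral_mul _
    hp.ennreal_ofReal hfy]
  rfl

lemma labelMeasure_univ (p : ℝ → ℝ) (y : Bool) :
    labelMeasure p y univ = ∫⁻ x in Icc (0:ℝ) 1, ENNReal.ofReal (p x) := by
  unfold labelMeasure
  rw [Measure.map_apply measurable_prodMk_right MeasurableSet.univ, preimage_univ,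
    withDensity_apply _ MeasurableSet.univ, Measure.restrict_univ]

lemma labelMeasure_add_univ {p q : ℝ → ℝ} (hp : IntegrableOn p (Icc 0 1))
    (hq : IntegrableOn q (Icc 0 1)) (hp0 : ∀ x, 0 ≤ p x) (hq0 : ∀ x, 0 ≤ q x) :
    (labelMeasure p true + labelMeasure q false) univ =
      ENNReal.ofReal (∫ x in Icc (0:ℝ) 1, (p x + q x)) := by
  rw [Measure.add_apply, labelMeasure_univ, labelMeasure_univ,
    ← ofReal_integral_eq_lintegral_ofReal hp (Filter.Eventually.of_forall hp0),
    ← ofReal_integral_eq_lintegral_ofReal hq (Filter.Eventually.of_forall hq0),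
    ← ENNReal.ofReal_add (integral_nonneg hp0) (integral_nonneg hq0), integral_add hp hq]

lemma isProbabilityMeasure_covMeasure {p η : ℝ → ℝ} (hp0 : ∀ x, 0 ≤ p x)
    (hp : ∫ x in Icc (0:ℝ) 1, p x = 1) (hη : ∀ x, 0 ≤ η x ∧ η x ≤ 1)
    (hc : ContinuousOn η (Icc 0 1)) : IsProbabilityMeasure (covMeasure p η) := by
  have hpi : IntegrableOn p (Icc 0 1) := by
    by_contra h
    rw [integral_undef h] at hp
    exact zero_ne_one hp
  have hm : AEStronglyMeasurable η (volume.restrict (Icc (0:ℝ) 1)) :=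
    hc.aestronglyMeasurable measurableSet_Icc
  have h1 : IntegrableOn (fun x => p x * η x) (Icc 0 1) :=
    hpi.mul_bdd (c := 1) hm (Filter.Eventually.of_forall fun x => by
      rw [Real.norm_eq_abs, abs_le]; constructor <;> linarith [hη x])
  have h2 : IntegrableOn (fun x => p x * (1 - η x)) (Icc 0 1) := by
    have : (fun x => p x * (1 - η x)) = fun x => p x - p x * η x := by ext x; ring
    rw [this]
    exact hpi.sub h1
  refine ⟨?_⟩
  unfold covMeasure
  rw [labelMeasure_add_univ h1 h2 (fun x => mul_nonneg (hp0 x) (hη x).1)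
    (fun x => mul_nonneg (hp0 x) (by linarith [hη x]))]
  have : ∀ x, p x * η x + p x * (1 - η x) = p x := fun x => by ring
  simp only [this, hp, ENNReal.ofReal_one]

lemma testMeasure_covMeasure {p q η : ℝ → ℝ} (hp : Measurable p) (hq : Measurable q)
    (hη : Measurable η) (hp0 : ∀ x, 0 ≤ p x) (hq0 : ∀ x, 0 ≤ q x)
    (hη1 : ∀ x, 0 ≤ η x ∧ η x ≤ 1) (hpq : ∀ x, p x + q x = 2) :
    testMeasure (covMeasure p η) (covMeasure q η) = covMeasure (fun _ => 1) η := by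
  have two : (2:ℝ≥0∞)⁻¹ = ENNReal.ofReal (1/2) := by
    rw [one_div, ENNReal.ofReal_inv_of_pos two_pos, ENNReal.ofReal_ofNat]
  have key : ∀ (θ : ℝ → ℝ), Measurable θ → (∀ x, 0 ≤ θ x) → ∀ y,
      (2 : ℝ≥0∞)⁻¹ • labelMeasure (fun x => p x * θ x) y +
        (2 : ℝ≥0∞)⁻¹ • labelMeasure (fun x => q x * θ x) y =
          labelMeasure (fun x => 1 * θ x) y := by
    intro θ hθ hθ0 y
    refine Measure.ext_of_lintegral _ fun f hf => ?_
    have hfy : Measurable fun x => f (x, y) := hf.comp measurable_prodMk_right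
    have hpθ : Measurable fun x => p x * θ x := hp.mul hθ
    have hqθ : Measurable fun x => q x * θ x := hq.mul hθ
    have h1θ : Measurable fun x => 1 * θ x := measurable_const.mul hθ
    rw [lintegral_add_measure, lintegral_smul_measure, lintegral_smul_measure,
      lintegral_labelMeasure hpθ y hf, lintegral_labelMeasure hqθ y hf,
      lintegral_labelMeasure h1θ y hf, smul_eq_mul, smul_eq_mul,
      ← lintegral_const_mul _ (by fun_prop), ← lintegral_const_mul _ (by fun_prop),
      ← lintegral_add_left (by fun_prop)]
    refine lintegral_congr fun x => ?_
    rw [two, ← mul_assoc, ← mul_assoc, ← add_mul,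
      ← ENNReal.ofReal_mul (by norm_num), ← ENNReal.ofReal_mul (by norm_num),
      ← ENNReal.ofReal_add (by have := hp0 x; have := hθ0 x; positivity)
        (by have := hq0 x; have := hθ0 x; positivity)]
    congr 2
    linear_combination (1/2 * θ x) * hpq x
  unfold testMeasure covMeasure
  rw [← key η hη (fun x => (hη1 x).1) true,
    ← key (fun x => 1 - η x) (measurable_const.sub hη) (fun x => by linarith [hη1 x]) false,
    smul_add, smul_add]
  abel

lemma risk_covMeasure_one {η : ℝ → ℝ} (hη : Measurable η) (hη1 : ∀ x, 0 ≤ η x ∧ η x ≤ 1)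
    {f : ℝ → Bool} (hf : Measurable f) :
    risk f (covMeasure (fun _ => 1) η) =
      ∫ x in Icc (0:ℝ) 1, if f x then 1 - η x else η x := by
  have hE : MeasurableSet {p : ℝ × Bool | f p.1 ≠ p.2} :=
    (measurableSet_eq_fun (hf.comp measurable_fst) measurable_snd).compl
  have hi : Measurable ({p : ℝ × Bool | f p.1 ≠ p.2}.indicator (1 : ℝ × Bool → ℝ≥0∞)) :=
    measurable_one.indicator hE
  have hη' : Measurable fun x => 1 * η x := measurable_const.mul hη
  have hη'' : Measurable fun x => 1 * (1 - η x) := measurable_const.mul (measurable_const.sub hη)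
  have hL : ∀ x, 0 ≤ (if f x then 1 - η x else η x) := fun x => by
    split_ifs <;> linarith [hη1 x]
  have hset : MeasurableSet {x | f x = true} := hf (measurableSet_singleton true)
  unfold risk
  rw [integral_eq_lintegral_of_nonneg_ae (Filter.Eventually.of_forall hL)
    (Measurable.ite hset (measurable_const.sub hη) hη).aestronglyMeasurable]
  congr 1
  unfold covMeasure
  rw [← lintegral_indicator_one hE, lintegral_add_measure, lintegral_labelMeasure hη' _ hi,
    lintegral_labelMeasure hη'' _ hi,
    ← lintegral_add_left (by fun_prop)]
  refine lintegral_congr fun x => ?_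
  cases h : f x <;> simp [indicator, h]

lemma LeGeomMean.labelMeasure {m p q : ℝ → ℝ} (hm : Measurable m) (hp : Measurable p)
    (hq : Measurable q) (hp0 : ∀ x, 0 ≤ p x) (hq0 : ∀ x, 0 ≤ q x)
    (h : ∀ x, m x ≤ √(p x) * √(q x)) (y : Bool) :
    LeGeomMean (labelMeasure m y) (labelMeasure p y) (labelMeasure q y) := by
  refine (LeGeomMean.withDensity _ hm.ennreal_ofReal hp.ennreal_ofReal hq.ennreal_ofReal
    fun x => ?_).map measurable_prodMk_right
  rw [ENNReal.ofReal_rpow_of_nonneg (hp0 x) (by norm_num),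
    ENNReal.ofReal_rpow_of_nonneg (hq0 x) (by norm_num), ← ENNReal.ofReal_mul (by
      have := hp0 x; positivity), ← Real.sqrt_eq_rpow, ← Real.sqrt_eq_rpow]
  exact ENNReal.ofReal_le_ofReal (h x)

end Labelled

section Hellinger

/-- The density-level geometric mean of `covMeasure p η` and `covMeasure p θ`. -/
def covGeomMean (p η θ : ℝ → ℝ) : Measure (ℝ × Bool) :=
  labelMeasure (fun x => p x * √(η x * θ x)) true +
    labelMeasure (fun x => p x * √((1 - η x) * (1 - θ x))) false

lemma leGeomMean_covGeomMean {p η θ : ℝ → ℝ} (hp : Measurable p) (hη : Measurable η)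
    (hθ : Measurable θ) (hp0 : ∀ x, 0 ≤ p x) (hη1 : ∀ x, 0 ≤ η x ∧ η x ≤ 1)
    (hθ1 : ∀ x, 0 ≤ θ x ∧ θ x ≤ 1) :
    LeGeomMean (covGeomMean p η θ) (covMeasure p η) (covMeasure p θ) := by
  have key : ∀ a b c : ℝ, 0 ≤ a → 0 ≤ b → a * √(b * c) ≤ √(a * b) * √(a * c) := by
    intro a b c ha hb
    rw [← Real.sqrt_mul (mul_nonneg ha hb), show a * b * (a * c) = a ^ 2 * (b * c) by ring,
      Real.sqrt_mul (sq_nonneg a), Real.sqrt_sq ha]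
  have hη' : ∀ x, 0 ≤ 1 - η x := fun x => by linarith [hη1 x]
  have hθ' : ∀ x, 0 ≤ 1 - θ x := fun x => by linarith [hθ1 x]
  refine LeGeomMean.add ?_ ?_
  · exact LeGeomMean.labelMeasure (by fun_prop) (by fun_prop) (by fun_prop)
      (fun x => mul_nonneg (hp0 x) (hη1 x).1) (fun x => mul_nonneg (hp0 x) (hθ1 x).1)
      (fun x => key _ _ _ (hp0 x) (hη1 x).1) _
  · exact LeGeomMean.labelMeasure (by fun_prop) (by fun_prop) (by fun_prop)
      (fun x => mul_nonneg (hp0 x) (hη' x)) (fun x => mul_nonneg (hp0 x) (hθ' x))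
      (fun x => key _ _ _ (hp0 x) (hη' x)) _

lemma covGeomMean_univ {p η θ : ℝ → ℝ} (hη : Measurable η)
    (hθ : Measurable θ) (hp0 : ∀ x, 0 ≤ p x) (hpi : IntegrableOn p (Icc 0 1))
    (hη1 : ∀ x, 0 ≤ η x ∧ η x ≤ 1) (hθ1 : ∀ x, 0 ≤ θ x ∧ θ x ≤ 1) :
    covGeomMean p η θ univ = ENNReal.ofReal
      (∫ x in Icc (0:ℝ) 1, p x * (√(η x * θ x) + √((1 - η x) * (1 - θ x)))) := by
  have hb : ∀ a b : ℝ, 0 ≤ a → a ≤ 1 → 0 ≤ b → b ≤ 1 → ‖√(a * b)‖ ≤ 1 := fun a b h0 h1 h2 h3 => by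
    rw [Real.norm_eq_abs, abs_of_nonneg (Real.sqrt_nonneg _), Real.sqrt_le_one]
    exact mul_le_one₀ h1 h2 h3
  have h1 : IntegrableOn (fun x => p x * √(η x * θ x)) (Icc 0 1) :=
    hpi.mul_bdd (c := 1) (Measurable.aestronglyMeasurable (by fun_prop))
      (Filter.Eventually.of_forall fun x => hb _ _ (hη1 x).1 (hη1 x).2 (hθ1 x).1 (hθ1 x).2)
  have h2 : IntegrableOn (fun x => p x * √((1 - η x) * (1 - θ x))) (Icc 0 1) :=
    hpi.mul_bdd (c := 1) (Measurable.aestronglyMeasurable (by fun_prop))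
      (Filter.Eventually.of_forall fun x => hb _ _ (by linarith [hη1 x]) (by linarith [hη1 x])
        (by linarith [hθ1 x]) (by linarith [hθ1 x]))
  unfold covGeomMean
  rw [labelMeasure_add_univ h1 h2 (fun x => mul_nonneg (hp0 x) (Real.sqrt_nonneg _))
    (fun x => mul_nonneg (hp0 x) (Real.sqrt_nonneg _))]
  simp only [mul_add]

end Hellinger

/-! ## A hard family of label distributions perturbed on the right half of `[0,1]` -/

section Tents

/-- The tent of height `1/(4K)` and slope `1` on the `j`-th of `K` equal bins of `[1/2, 1]`. -/
def tent (K : ℕ) (j : Fin K) (x : ℝ) : ℝ :=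
  max 0 (1/(4*(K:ℝ)) - |x - (1/2 + (2*(j:ℝ)+1)/(4*(K:ℝ)))|)

/-- The label distribution equal to `1/2` perturbed by signed tents. -/
def tentEta (K : ℕ) (v : Fin K → Bool) (x : ℝ) : ℝ :=
  1/2 + (1/2) * ∑ j : Fin K, sgnB (v j) * tent K j x

variable {K : ℕ}

lemma tent_nonneg (j : Fin K) (x : ℝ) : 0 ≤ tent K j x := le_max_left _ _

lemma tent_le (j : Fin K) (x : ℝ) : tent K j x ≤ 1/(4*(K:ℝ)) :=
  max_le (by positivity) (by linarith [abs_nonneg (x - (1/2 + (2*(j:ℝ)+1)/(4*(K:ℝ))))])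

lemma inv_four_mul_le_one (K : ℕ) : 1/(4*(K:ℝ)) ≤ 1 := by
  rcases K.eq_zero_or_pos with rfl | hK
  · simp
  · have : (1:ℝ) ≤ K := by exact_mod_cast hK
    rw [div_le_one (by positivity)]
    linarith

lemma tent_le_one (j : Fin K) (x : ℝ) : tent K j x ≤ 1 :=
  (tent_le j x).trans (inv_four_mul_le_one K)

lemma continuous_tent (j : Fin K) : Continuous (tent K j) := by
  unfold tent
  fun_prop

lemma continuous_tentEta (v : Fin K → Bool) : Continuous (tentEta K v) := by
  have := fun j : Fin K => continuous_tent j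
  unfold tentEta
  fun_prop

lemma tent_sub_le (j : Fin K) (x y : ℝ) : tent K j x - tent K j y ≤ |x - y| := by
  unfold tent
  set c : ℝ := 1/2 + (2*(j:ℝ)+1)/(4*(K:ℝ))
  have h := abs_sub_abs_le_abs_sub (y - c) (x - c)
  rw [show y - c - (x - c) = y - x by ring, abs_sub_comm y x] at h
  have h0 := abs_nonneg (x - y)
  rw [sub_le_iff_le_add]
  refine max_le (add_nonneg h0 (le_max_left _ _)) ?_
  have := le_max_right 0 (1/(4*(K:ℝ)) - |y - c|)
  linarith

lemma abs_sub_lt_of_tent_pos {j : Fin K} {x : ℝ} (h : 0 < tent K j x) :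
    |x - (1/2 + (2*(j:ℝ)+1)/(4*(K:ℝ)))| < 1/(4*(K:ℝ)) := by
  rcases lt_max_iff.1 h with h | h
  · exact absurd h (lt_irrefl _)
  · linarith

lemma half_lt_of_tent_pos {j : Fin K} {x : ℝ} (h : 0 < tent K j x) : 1/2 < x := by
  have h1 := (abs_lt.1 (abs_sub_lt_of_tent_pos h)).1
  have h2 : 1/(4*(K:ℝ)) ≤ (2*(j:ℝ)+1)/(4*(K:ℝ)) := by
    gcongr
    have : (0:ℝ) ≤ j := by positivity
    linarith
  linarith

lemma eq_of_tent_pos {i j : Fin K} {x : ℝ} (hi : 0 < tent K i x) (hj : 0 < tent K j x) :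
    i = j := by
  have hK : (0:ℝ) < K := by exact_mod_cast (Fin.pos i)
  have key : ∀ {i j : Fin K}, 0 < tent K i x → 0 < tent K j x → (i:ℕ) < (j:ℕ) + 1 := by
    intro i j hi hj
    have h1 := (abs_lt.1 (abs_sub_lt_of_tent_pos hi)).1
    have h2 := (abs_lt.1 (abs_sub_lt_of_tent_pos hj)).2
    have h3 : (2*(i:ℝ)+1)/(4*(K:ℝ)) < (2*(j:ℝ)+1)/(4*(K:ℝ)) + (1/(4*(K:ℝ)) + 1/(4*(K:ℝ))) := by
      linarith
    rw [← add_div, ← add_div, div_lt_div_iff_of_pos_right (by positivity)] at h3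
    have h4 : (i:ℝ) < (j:ℝ) + 1 := by linarith
    exact_mod_cast h4
  have := key hi hj
  have := key hj hi
  exact Fin.ext (by omega)

lemma tent_eq_zero_of_pos_of_ne {i j : Fin K} {x : ℝ} (hi : 0 < tent K i x) (hj : j ≠ i) :
    tent K j x = 0 := by
  by_contra h
  exact hj (eq_of_tent_pos ((tent_nonneg j x).lt_of_ne' h) hi)

lemma tent_all_zero_or_exists_pos (x : ℝ) :
    (∀ j, tent K j x = 0) ∨ ∃ i, 0 < tent K i x := by
  by_cases h : ∃ i, 0 < tent K i x
  · exact Or.inr h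
  · push Not at h
    exact Or.inl fun j => le_antisymm (h j) (tent_nonneg j x)

lemma sum_le_of_supported_tent {F : Fin K → ℝ} {C x : ℝ} (hC : 0 ≤ C) (hF : ∀ j, F j ≤ C)
    (h0 : ∀ j, tent K j x = 0 → F j ≤ 0) : ∑ j, F j ≤ C := by
  rcases tent_all_zero_or_exists_pos (K := K) x with h | ⟨i, hi⟩
  · exact (Finset.sum_nonpos fun j _ => h0 j (h j)).trans hC
  · rw [← Finset.add_sum_erase _ _ (Finset.mem_univ i)]
    have : ∑ j ∈ Finset.univ.erase i, F j ≤ 0 := Finset.sum_nonpos fun j hj =>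
      h0 j (tent_eq_zero_of_pos_of_ne hi (Finset.ne_of_mem_erase hj))
    linarith [hF i]

lemma abs_sgnB (b : Bool) : |sgnB b| = 1 := by cases b <;> simp [sgnB]

lemma tentEta_of_pos (v : Fin K → Bool) {i : Fin K} {x : ℝ} (hi : 0 < tent K i x) :
    tentEta K v x = 1/2 + (1/2) * (sgnB (v i) * tent K i x) := by
  unfold tentEta
  rw [Finset.sum_eq_single i (fun j _ hj => by rw [tent_eq_zero_of_pos_of_ne hi hj, mul_zero])
    (by simp)]

lemma tentEta_of_all_zero (v : Fin K → Bool) {x : ℝ} (h : ∀ j, tent K j x = 0) :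
    tentEta K v x = 1/2 := by
  simp [tentEta, h]

lemma tentEta_mem (v : Fin K → Bool) (x : ℝ) : 0 ≤ tentEta K v x ∧ tentEta K v x ≤ 1 := by
  rcases tent_all_zero_or_exists_pos (K := K) x with h | ⟨i, hi⟩
  · rw [tentEta_of_all_zero v h]
    norm_num
  · rw [tentEta_of_pos v hi]
    have := tent_le_one i x
    cases v i <;> simp only [sgnB] <;> constructor <;> norm_num <;> linarith

lemma abs_tentEta_sub_le (v : Fin K → Bool) (x y : ℝ) :
    |tentEta K v x - tentEta K v y| ≤ |x - y| := by
  have one_side : ∀ x y : ℝ, ∑ j : Fin K, max 0 (tent K j x - tent K j y) ≤ |x - y| := fun x y =>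
    sum_le_of_supported_tent (x := x) (abs_nonneg _)
      (fun j => max_le (abs_nonneg _) (tent_sub_le j x y))
      (fun j hj => max_le le_rfl (by linarith [tent_nonneg j y]))
  have habs : ∀ j : Fin K, |sgnB (v j) * (tent K j x - tent K j y)| ≤
      max 0 (tent K j x - tent K j y) + max 0 (tent K j y - tent K j x) := by
    intro j
    rw [abs_mul, abs_sgnB, one_mul]
    have h1 := le_max_left 0 (tent K j x - tent K j y)
    have h2 := le_max_right 0 (tent K j x - tent K j y)
    have h3 := le_max_left 0 (tent K j y - tent K j x)
    have h4 := le_max_right 0 (tent K j y - tent K j x)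
    exact abs_le.2 ⟨by linarith, by linarith⟩
  have heq : tentEta K v x - tentEta K v y =
      (1/2) * ∑ j : Fin K, sgnB (v j) * (tent K j x - tent K j y) := by
    simp only [tentEta, mul_sub, Finset.sum_sub_distrib]
    ring
  have hsum : |∑ j : Fin K, sgnB (v j) * (tent K j x - tent K j y)| ≤ |x - y| + |x - y| :=
    calc _ ≤ ∑ j : Fin K, |sgnB (v j) * (tent K j x - tent K j y)| :=
          Finset.abs_sum_le_sum_abs _ _
      _ ≤ ∑ j : Fin K, (max 0 (tent K j x - tent K j y) + max 0 (tent K j y - tent K j x)) :=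
          Finset.sum_le_sum fun j _ => habs j
      _ ≤ |x - y| + |y - x| := by
          rw [Finset.sum_add_distrib]
          exact add_le_add (one_side x y) (one_side y x)
      _ = _ := by rw [abs_sub_comm y x]
  rw [heq, abs_mul, abs_of_nonneg (by norm_num : (0:ℝ) ≤ 1/2)]
  linarith

lemma lipschitzWith_tentEta (v : Fin K → Bool) : LipschitzWith 1 (tentEta K v) :=
  LipschitzWith.of_dist_le_mul fun x y => by
    simpa only [Real.dist_eq, NNReal.coe_one, one_mul] using abs_tentEta_sub_le v x y

lemma lipschitzWith_one_sub_tentEta (v : Fin K → Bool) :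
    LipschitzWith 1 (fun x => 1 - tentEta K v x) :=
  LipschitzWith.of_dist_le_mul fun x y => by
    rw [Real.dist_eq, Real.dist_eq, NNReal.coe_one, one_mul, sub_sub_sub_cancel_left, abs_sub_comm]
    exact abs_tentEta_sub_le v x y

lemma one_sub_sq_tent_le (v : Fin K → Bool) (j : Fin K) (x : ℝ) :
    1 - tent K j x ^ 2 ≤
      √(tentEta K v x * tentEta K (Function.update v j (!v j)) x) +
        √((1 - tentEta K v x) * (1 - tentEta K (Function.update v j (!v j)) x)) := by
  have hv := tentEta_mem v x
  by_cases hj : 0 < tent K j x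
  · set b := tent K j x with hb
    have h1 := tent_le_one j x
    have hs : (1 - b^2)/2 ≤ √((1 - b^2)/4) := by
      apply Real.le_sqrt_of_sq_le
      nlinarith [mul_nonneg (sq_nonneg b) (show 0 ≤ 1 - b^2 by nlinarith)]
    have e1 : tentEta K v x * tentEta K (Function.update v j (!v j)) x = (1 - b^2)/4 := by
      rw [tentEta_of_pos _ hj, tentEta_of_pos _ hj, Function.update_self]
      cases v j <;> simp [sgnB] <;> ring
    have e2 : (1 - tentEta K v x) * (1 - tentEta K (Function.update v j (!v j)) x) =
        (1 - b^2)/4 := by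
      rw [tentEta_of_pos _ hj, tentEta_of_pos _ hj, Function.update_self]
      cases v j <;> simp [sgnB] <;> ring
    rw [e1, e2]
    linarith
  · have h0 : tent K j x = 0 := le_antisymm (not_lt.1 hj) (tent_nonneg j x)
    have heq : tentEta K (Function.update v j (!v j)) x = tentEta K v x := by
      unfold tentEta
      congr 2
      refine Finset.sum_congr rfl fun i _ => ?_
      by_cases hi : i = j
      · rw [hi, h0, mul_zero, mul_zero]
      · rw [Function.update_of_ne hi]
    rw [heq, Real.sqrt_mul_self hv.1, Real.sqrt_mul_self (by linarith), h0]
    linarith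

lemma sum_tent_le_loss_sub (v : Fin K → Bool) (x : ℝ) (b : Bool) :
    ∑ j, tent K j x * (if b ≠ v j then 1 else 0) ≤
      (if b then 1 - tentEta K v x else tentEta K v x) -
        (if decide (1/2 ≤ tentEta K v x) then 1 - tentEta K v x else tentEta K v x) := by
  rcases tent_all_zero_or_exists_pos (K := K) x with h | ⟨i, hi⟩
  · rw [tentEta_of_all_zero v h]
    simp only [h, zero_mul, Finset.sum_const_zero]
    split_ifs <;> norm_num
  · rw [tentEta_of_pos v hi, Finset.sum_eq_single i
      (fun j _ hj => by rw [tent_eq_zero_of_pos_of_ne hi hj, zero_mul]) (by simp)]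
    simp only [decide_eq_true_eq]
    cases b <;> cases v i <;> simp only [sgnB] <;> split_ifs <;> simp_all <;> linarith

lemma integral_tent (j : Fin K) : ∫ x in Icc (0:ℝ) 1, tent K j x = (1/(4*(K:ℝ)))^2 := by
  have hK : (0:ℝ) < K := by exact_mod_cast (Fin.pos j)
  have hj : (j:ℝ) + 1 ≤ K := by exact_mod_cast j.2
  set a : ℝ := 1/(4*(K:ℝ)) with ha
  set c : ℝ := 1/2 + (2*(j:ℝ)+1)/(4*(K:ℝ)) with hc
  have ha0 : 0 < a := by positivity
  have hca : 0 ≤ c - a := by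
    have h2 : a ≤ (2*(j:ℝ)+1)/(4*(K:ℝ)) := by
      rw [ha]
      gcongr
      have : (0:ℝ) ≤ j := by positivity
      linarith
    linarith
  have hca' : c + a ≤ 1 := by
    have : (2*(j:ℝ)+1)/(4*(K:ℝ)) + a ≤ 1/2 := by
      rw [ha, ← add_div, div_le_iff₀ (by positivity)]
      linarith
    linarith
  have hcont := continuous_tent j
  rw [setIntegral_eq_of_subset_of_forall_sdiff_eq_zero measurableSet_Icc
    (Icc_subset_Icc hca hca') (fun x hx => ?_), integral_Icc_eq_integral_Ioc,
    ← intervalIntegral.integral_of_le (by linarith),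
    ← intervalIntegral.integral_add_adjacent_intervals (b := c)
      (hcont.intervalIntegrable _ _) (hcont.intervalIntegrable _ _)]
  · have h1 : ∫ x in (c-a)..c, tent K j x = ∫ x in (c-a)..c, (x - (c - a)) := by
      refine intervalIntegral.integral_congr fun x hx => ?_
      rw [uIcc_of_le (by linarith)] at hx
      simp only [tent, ← ha, ← hc]
      rw [abs_of_nonpos (by linarith [hx.2]), max_eq_right (by linarith [hx.1])]
      ring
    have h2 : ∫ x in c..(c+a), tent K j x = ∫ x in c..(c+a), ((c + a) - x) := by
      refine intervalIntegral.integral_congr fun x hx => ?_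
      rw [uIcc_of_le (by linarith)] at hx
      simp only [tent, ← ha, ← hc]
      rw [abs_of_nonneg (by linarith [hx.1]), max_eq_right (by linarith [hx.2])]
      ring
    rw [h1, h2, intervalIntegral.integral_comp_sub_right (fun x => x),
      intervalIntegral.integral_comp_sub_left (fun x => x), integral_id, integral_id]
    ring
  · by_contra h
    have := abs_lt.1 (abs_sub_lt_of_tent_pos ((tent_nonneg j x).lt_of_ne' h))
    exact hx.2 ⟨by linarith [this.1], by linarith [this.2]⟩

end Tents

/-! ## Group densities and the affinity of neighbouring instances -/

section Instances

variable {τ : ℝ}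

lemma measurable_hardPa : Measurable (hardPa τ) := by
  unfold hardPa
  exact Measurable.ite measurableSet_Iio measurable_const measurable_const

lemma measurable_hardPb : Measurable (hardPb τ) := measurable_const.sub measurable_hardPa

lemma hardPa_nonneg (hτ : τ ∈ Icc (0:ℝ) 1) (x : ℝ) : 0 ≤ hardPa τ x := by
  unfold hardPa
  split_ifs <;> linarith [hτ.1, hτ.2]

lemma hardPb_nonneg (hτ : τ ∈ Icc (0:ℝ) 1) (x : ℝ) : 0 ≤ hardPb τ x := by
  unfold hardPb hardPa
  split_ifs <;> linarith [hτ.1, hτ.2]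

lemma integrableOn_hardPa_and_integral :
    IntegrableOn (hardPa τ) (Icc 0 1) ∧ ∫ x in Icc (0:ℝ) 1, hardPa τ x = 1 := by
  have heq : hardPa τ = fun x => τ + (Iio (1/2:ℝ)).indicator (fun _ => 2 - 2*τ) x := by
    ext x
    by_cases hx : x < 1/2
    · rw [hardPa, if_pos hx, indicator_of_mem (mem_Iio.2 hx)]
      ring
    · rw [hardPa, if_neg hx, indicator_of_notMem (by simpa using hx), add_zero]
  have hc : ∀ c : ℝ, Integrable (fun _ : ℝ => c) (volume.restrict (Icc (0:ℝ) 1)) :=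
    fun c => integrable_const c
  have hi := (hc (2 - 2*τ)).indicator (measurableSet_Iio (a := (1/2:ℝ)))
  have hset : Iio (1/2:ℝ) ∩ Icc 0 1 = Ico 0 (1/2) := by
    ext x
    simp only [mem_inter_iff, mem_Iio, mem_Icc, mem_Ico]
    constructor
    · rintro ⟨h1, h2, h3⟩
      exact ⟨h2, h1⟩
    · rintro ⟨h1, h2⟩
      exact ⟨h2, h1, by linarith⟩
  rw [heq]
  refine ⟨(hc τ).add hi, ?_⟩
  rw [integral_add (hc τ) hi, integral_indicator measurableSet_Iio,
    Measure.restrict_restrict measurableSet_Iio, hset]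
  simp
  ring

lemma integrableOn_hardPb_and_integral :
    IntegrableOn (hardPb τ) (Icc 0 1) ∧ ∫ x in Icc (0:ℝ) 1, hardPb τ x = 1 := by
  obtain ⟨h1, h2⟩ := integrableOn_hardPa_and_integral (τ := τ)
  have hc : Integrable (fun _ : ℝ => (2:ℝ)) (volume.restrict (Icc (0:ℝ) 1)) := integrable_const _
  refine ⟨hc.sub h1, ?_⟩
  unfold hardPb
  rw [integral_sub hc h1, h2]
  simp
  norm_num

lemma tvDist_hardPa_hardPb (hτ : τ ∈ Icc (0:ℝ) 1) :
    tvDist (hardPa τ) (hardPb τ) = 1 - τ := by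
  have h : ∀ x, |hardPa τ x - hardPb τ x| = 2 - 2*τ := by
    intro x
    unfold hardPb hardPa
    split_ifs
    · rw [abs_of_nonneg] <;> linarith [hτ.2]
    · rw [abs_of_nonpos] <;> linarith [hτ.2]
  simp only [tvDist, h]
  simp
  ring

variable {K : ℕ}

lemma memGS_tentEta (hτ : τ ∈ Icc (0:ℝ) 1) (v : Fin K → Bool) :
    memGS τ (covMeasure (hardPa τ) (tentEta K v)) (covMeasure (hardPb τ) (tentEta K v)) :=
  ⟨hardPa τ, hardPb τ, tentEta K v, hardPa_nonneg hτ, hardPb_nonneg hτ,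
    integrableOn_hardPa_and_integral.2, integrableOn_hardPb_and_integral.2, tentEta_mem v,
    (lipschitzWith_tentEta v).lipschitzOnWith, (lipschitzWith_one_sub_tentEta v).lipschitzOnWith,
    by rw [tvDist_hardPa_hardPb hτ]; linarith, rfl, rfl⟩

lemma isProbabilityMeasure_of_memGS {Pmaj Pmin : Measure (ℝ × Bool)} (h : memGS τ Pmaj Pmin) :
    IsProbabilityMeasure Pmaj ∧ IsProbabilityMeasure Pmin := by
  obtain ⟨pa, pb, η, ha0, hb0, ha, hb, hη, hL, -, -, rfl, rfl⟩ := h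
  exact ⟨isProbabilityMeasure_covMeasure ha0 ha hη hL.continuousOn,
    isProbabilityMeasure_covMeasure hb0 hb hη hL.continuousOn⟩

lemma isFiniteMeasure_covGeomMean {p : ℝ → ℝ} (hp0 : ∀ x, 0 ≤ p x)
    (hpi : IntegrableOn p (Icc 0 1)) (v w : Fin K → Bool) :
    IsFiniteMeasure (covGeomMean p (tentEta K v) (tentEta K w)) := by
  refine ⟨?_⟩
  rw [covGeomMean_univ (continuous_tentEta v).measurable (continuous_tentEta w).measurable
    hp0 hpi (tentEta_mem v) (tentEta_mem w)]
  exact ENNReal.ofReal_lt_top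

lemma one_sub_le_covGeomMean_univ {p : ℝ → ℝ} {t : ℝ} (hp0 : ∀ x, 0 ≤ p x)
    (hpi : IntegrableOn p (Icc 0 1)) (hp1 : ∫ x in Icc (0:ℝ) 1, p x = 1) (ht0 : 0 ≤ t)
    (ht : ∀ x, 1/2 < x → p x = t) (v : Fin K → Bool) (j : Fin K) :
    1 - t * (1/(4*(K:ℝ)))^3 ≤
      (covGeomMean p (tentEta K v) (tentEta K (Function.update v j (!v j)))).real univ := by
  set w := Function.update v j (!v j) with hw
  have hmv := (continuous_tentEta v).measurable
  have hmw := (continuous_tentEta w).measurable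
  have hsqrt : ∀ a b : ℝ, 0 ≤ a → a ≤ 1 → 0 ≤ b → b ≤ 1 → √(a * b) ≤ 1 := fun a b h0 h1 h2 h3 => by
    rw [Real.sqrt_le_one]
    exact mul_le_one₀ h1 h2 h3
  have htent : Integrable (tent K j) (volume.restrict (Icc (0:ℝ) 1)) :=
    (continuous_tent j).continuousOn.integrableOn_compact isCompact_Icc
  have hint : IntegrableOn (fun x => p x * (√(tentEta K v x * tentEta K w x) +
      √((1 - tentEta K v x) * (1 - tentEta K w x)))) (Icc 0 1) := by
    refine hpi.mul_bdd (c := 2) (Measurable.aestronglyMeasurable (by fun_prop))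
      (Filter.Eventually.of_forall fun x => ?_)
    have hv1 := tentEta_mem v x
    have hw1 := tentEta_mem w x
    rw [Real.norm_eq_abs, abs_of_nonneg (by positivity)]
    linarith [hsqrt _ _ hv1.1 hv1.2 hw1.1 hw1.2,
      hsqrt (1 - tentEta K v x) (1 - tentEta K w x) (by linarith) (by linarith) (by linarith)
        (by linarith)]
  have hpt : ∀ x, p x - t * (1/(4*(K:ℝ))) * tent K j x ≤
      p x * (√(tentEta K v x * tentEta K w x) +
        √((1 - tentEta K v x) * (1 - tentEta K w x))) := by
    intro x
    refine le_trans ?_ (mul_le_mul_of_nonneg_left (one_sub_sq_tent_le v j x) (hp0 x))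
    by_cases hx : 0 < tent K j x
    · rw [ht x (half_lt_of_tent_pos hx)]
      have := mul_le_mul_of_nonneg_left (mul_le_mul_of_nonneg_right (tent_le j x) hx.le) ht0
      linarith
    · rw [le_antisymm (not_lt.1 hx) (tent_nonneg j x)]
      simp
  rw [measureReal_def, covGeomMean_univ hmv hmw hp0 hpi (tentEta_mem v) (tentEta_mem w),
    ENNReal.toReal_ofReal (integral_nonneg fun x => mul_nonneg (hp0 x) (by positivity))]
  calc 1 - t * (1/(4*(K:ℝ)))^3
      = ∫ x in Icc (0:ℝ) 1, (p x - t * (1/(4*(K:ℝ))) * tent K j x) := by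
        rw [integral_sub hpi (htent.const_mul _), hp1, integral_const_mul, integral_tent]
        ring
    _ ≤ _ := integral_mono (hpi.sub (htent.const_mul _)) hint hpt

lemma exp_neg_two_mul_le_one_sub {u : ℝ} (h0 : 0 ≤ u) (h1 : u ≤ 1/2) :
    Real.exp (-(2*u)) ≤ 1 - u := by
  rw [Real.exp_neg]
  refine inv_le_of_inv_le₀ (by linarith) ?_
  refine le_trans ?_ (Real.add_one_le_exp (2*u))
  rw [inv_le_iff_one_le_mul₀ (by linarith)]
  nlinarith

lemma exp_le_affinity_sq {N M : ℕ} {a b : ℝ} (hK : 0 < K) (hτ : τ ∈ Icc (0:ℝ) 1)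
    (ha : 1 - τ * (1/(4*(K:ℝ)))^3 ≤ a) (hb : 1 - (2 - τ) * (1/(4*(K:ℝ)))^3 ≤ b) :
    Real.exp (-((M : ℝ)*(2-τ) + (N : ℝ)*τ)/(3*(K:ℝ)^3)) ≤ (a ^ N * b ^ M) ^ 2 := by
  have hK1 : (1:ℝ) ≤ K := by exact_mod_cast hK
  set d : ℝ := (1/(4*(K:ℝ)))^3 with hd
  have hd0 : 0 ≤ d := by positivity
  have hd1 : d ≤ 1/64 := by
    calc d ≤ (1/(4*1))^3 := by rw [hd]; gcongr
      _ = _ := by norm_num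
  have hu1 : Real.exp (-(2*(τ*d))) ≤ a :=
    (exp_neg_two_mul_le_one_sub (mul_nonneg hτ.1 hd0) (by nlinarith [hτ.1, hτ.2])).trans ha
  have hu2 : Real.exp (-(2*((2-τ)*d))) ≤ b :=
    (exp_neg_two_mul_le_one_sub (mul_nonneg (by linarith [hτ.2]) hd0)
      (by nlinarith [hτ.1, hτ.2])).trans hb
  have ha0 : 0 ≤ a := (Real.exp_pos _).le.trans hu1
  have hL : 0 ≤ (M:ℝ)*(2-τ) + (N:ℝ)*τ :=
    add_nonneg (mul_nonneg (by positivity) (by linarith [hτ.2])) (mul_nonneg (by positivity) hτ.1)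
  calc Real.exp (-((M : ℝ)*(2-τ) + (N : ℝ)*τ)/(3*(K:ℝ)^3))
      ≤ Real.exp (-(4 * d * ((M : ℝ)*(2-τ) + (N : ℝ)*τ))) := by
        apply Real.exp_le_exp.2
        have h3 : 4 * d ≤ 1/(3*(K:ℝ)^3) := by
          rw [hd, show 4 * (1/(4*(K:ℝ)))^3 = 1/(16*(K:ℝ)^3) by field_simp; norm_num]
          gcongr
          norm_num
        have := mul_le_mul_of_nonneg_right h3 hL
        rw [neg_div, neg_le_neg_iff]
        refine this.trans (le_of_eq ?_)
        ring
    _ = (Real.exp (-(2*(τ*d))) ^ N * Real.exp (-(2*((2-τ)*d))) ^ M) ^ 2 := by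
        rw [← Real.exp_nat_mul, ← Real.exp_nat_mul, ← Real.exp_add, ← Real.exp_nat_mul]
        congr 1
        push_cast
        ring
    _ ≤ _ := by gcongr

/-- The law of the sample for the instance with label distribution `tentEta K v`. -/
def tentSample (K nmaj nmin : ℕ) (τ : ℝ) (v : Fin K → Bool) : Measure (Sample nmaj nmin) :=
  sampleMeasure nmaj nmin (covMeasure (hardPa τ) (tentEta K v))
    (covMeasure (hardPb τ) (tentEta K v))

variable {nmaj nmin : ℕ}

lemma isProbabilityMeasure_sampleMeasure (P Q : Measure (ℝ × Bool)) [IsProbabilityMeasure P]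
    [IsProbabilityMeasure Q] : IsProbabilityMeasure (sampleMeasure nmaj nmin P Q) := by
  unfold sampleMeasure
  infer_instance

lemma isProbabilityMeasure_tentSample (hτ : τ ∈ Icc (0:ℝ) 1) (v : Fin K → Bool) :
    IsProbabilityMeasure (tentSample K nmaj nmin τ v) := by
  obtain ⟨h1, h2⟩ := isProbabilityMeasure_of_memGS (memGS_tentEta hτ v)
  exact isProbabilityMeasure_sampleMeasure _ _

lemma exp_le_two_point_error (hτ : τ ∈ Icc (0:ℝ) 1) (v : Fin K → Bool) (j : Fin K)
    {E : Set (Sample nmaj nmin)} (hE : MeasurableSet E) :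
    Real.exp (-((nmin : ℝ)*(2-τ) + (nmaj : ℝ)*τ)/(3*(K:ℝ)^3)) ≤
      2 * ((tentSample K nmaj nmin τ v).real E +
        (tentSample K nmaj nmin τ (Function.update v j (!v j))).real Eᶜ) := by
  set w := Function.update v j (!v j) with hw
  obtain ⟨ha, ha1⟩ := integrableOn_hardPa_and_integral (τ := τ)
  obtain ⟨hb, hb1⟩ := integrableOn_hardPb_and_integral (τ := τ)
  have hτ2 : 0 ≤ 2 - τ := by linarith [hτ.2]
  have hPa : ∀ x, 1/2 < x → hardPa τ x = τ := fun x hx => if_neg (not_lt.2 hx.le)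
  have hPb : ∀ x, 1/2 < x → hardPb τ x = 2 - τ := fun x hx => by rw [hardPb, hPa x hx]
  have hmv := (continuous_tentEta v).measurable
  have hmw := (continuous_tentEta w).measurable
  have := isFiniteMeasure_covGeomMean (hardPa_nonneg hτ) ha v w
  have := isFiniteMeasure_covGeomMean (hardPb_nonneg hτ) hb v w
  obtain ⟨_, _⟩ := isProbabilityMeasure_of_memGS (memGS_tentEta hτ v)
  obtain ⟨_, _⟩ := isProbabilityMeasure_of_memGS (memGS_tentEta hτ w)
  have := isProbabilityMeasure_tentSample (nmaj := nmaj) (nmin := nmin) hτ v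
  have := isProbabilityMeasure_tentSample (nmaj := nmaj) (nmin := nmin) hτ w
  have hle : LeGeomMean (sampleMeasure nmaj nmin (covGeomMean (hardPa τ) (tentEta K v) (tentEta K w))
      (covGeomMean (hardPb τ) (tentEta K v) (tentEta K w))) (tentSample K nmaj nmin τ v)
      (tentSample K nmaj nmin τ w) :=
    ((leGeomMean_covGeomMean measurable_hardPa hmv hmw (hardPa_nonneg hτ) (tentEta_mem v)
      (tentEta_mem w)).pi nmaj).prod
    ((leGeomMean_covGeomMean measurable_hardPb hmv hmw (hardPb_nonneg hτ) (tentEta_mem v)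
      (tentEta_mem w)).pi nmin)
  refine le_trans ?_ (hle.sq_measure_univ_le hE)
  have hmass : (sampleMeasure nmaj nmin (covGeomMean (hardPa τ) (tentEta K v) (tentEta K w))
      (covGeomMean (hardPb τ) (tentEta K v) (tentEta K w))).real univ =
      (covGeomMean (hardPa τ) (tentEta K v) (tentEta K w)).real univ ^ nmaj *
        (covGeomMean (hardPb τ) (tentEta K v) (tentEta K w)).real univ ^ nmin := by
    simp only [sampleMeasure, measureReal_def]
    rw [← univ_prod_univ, Measure.prod_prod, Measure.pi_univ, Measure.pi_univ]
    simp
  rw [hmass]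
  exact exp_le_affinity_sq (Fin.pos j) hτ
    (one_sub_le_covGeomMean_univ (hardPa_nonneg hτ) ha ha1 hτ.1 hPa v j)
    (one_sub_le_covGeomMean_univ (hardPb_nonneg hτ) hb hb1 hτ2 hPb v j)

lemma exp_le_sum_error (hτ : τ ∈ Icc (0:ℝ) 1) (j : Fin K) {h : Sample nmaj nmin → Bool}
    (hh : Measurable h) :
    2 ^ K * Real.exp (-((nmin : ℝ)*(2-τ) + (nmaj : ℝ)*τ)/(3*(K:ℝ)^3)) / 4 ≤
      ∑ v : Fin K → Bool, (tentSample K nmaj nmin τ v).real {S | h S ≠ v j} := by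
  have hinv : Function.Involutive (fun v : Fin K → Bool => Function.update v j (!v j)) := by
    intro v
    simp
  let flip : Equiv.Perm (Fin K → Bool) := Function.Involutive.toPerm _ hinv
  have hflip_apply : ∀ v, flip v = Function.update v j (!v j) := fun v => rfl
  have hflip := Equiv.sum_comp flip
    (fun v : Fin K → Bool => (tentSample K nmaj nmin τ v).real {S | h S ≠ v j})
  have hlow : ∑ _v : Fin K → Bool,
      Real.exp (-((nmin : ℝ)*(2-τ) + (nmaj : ℝ)*τ)/(3*(K:ℝ)^3)) / 2 ≤
      ∑ v : Fin K → Bool, ((tentSample K nmaj nmin τ v).real {S | h S ≠ v j} +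
        (tentSample K nmaj nmin τ (flip v)).real {S | h S ≠ flip v j}) := by
    refine Finset.sum_le_sum fun v _ => ?_
    have hset : {S | h S ≠ flip v j} = {S | h S ≠ v j}ᶜ := by
      ext S
      simp only [hflip_apply, Function.update_self, mem_ofPred_eq,
        mem_compl_iff, not_not]
      cases h S <;> cases v j <;> simp
    rw [hset]
    have := exp_le_two_point_error hτ v j
      (E := {S | h S ≠ v j}) (hh (measurableSet_singleton (v j))).compl
    simp only [hflip_apply]
    linarith
  rw [Finset.sum_add_distrib, hflip] at hlow
  simp only [Finset.sum_const, Finset.card_univ, Fintype.card_fun, Fintype.card_bool,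
    Fintype.card_fin, nsmul_eq_mul, Nat.cast_pow, Nat.cast_ofNat] at hlow
  linarith

end Instances

/-! ## Reduction of the excess risk to testing -/

section Excess

variable {τ : ℝ} {K nmaj nmin : ℕ}

lemma risk_nonneg (f : ℝ → Bool) (P : Measure (ℝ × Bool)) : 0 ≤ risk f P := ENNReal.toReal_nonneg

lemma bayesRisk_le_risk (f : ℝ → Bool) (P : Measure (ℝ × Bool)) : bayesRisk P ≤ risk f P :=
  ciInf_le ⟨0, by rintro _ ⟨g, rfl⟩; exact risk_nonneg g P⟩ f

lemma excessRisk_le_one (A : Sample nmaj nmin → ℝ → Bool) (P Q : Measure (ℝ × Bool))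
    [IsProbabilityMeasure P] [IsProbabilityMeasure Q] : excessRisk nmaj nmin A P Q ≤ 1 := by
  have := isProbabilityMeasure_sampleMeasure (nmaj := nmaj) (nmin := nmin) P Q
  have htest : IsProbabilityMeasure (testMeasure P Q) := ⟨by
    simp [testMeasure, ENNReal.inv_two_add_inv_two]⟩
  have hbayes : 0 ≤ bayesRisk (testMeasure P Q) := Real.iInf_nonneg fun f => risk_nonneg f _
  have hint : ∫ S, risk (A S) (testMeasure P Q) ∂sampleMeasure nmaj nmin P Q ≤
      ∫ _S, (1:ℝ) ∂sampleMeasure nmaj nmin P Q :=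
    integral_mono_of_nonneg (Filter.Eventually.of_forall fun S => risk_nonneg _ _)
      (integrable_const _) (Filter.Eventually.of_forall fun S => measureReal_le_one)
  rw [integral_const, probReal_univ, one_smul] at hint
  unfold excessRisk
  linarith

lemma sum_integral_le_excessRisk (hτ : τ ∈ Icc (0:ℝ) 1) (v : Fin K → Bool)
    {A : Sample nmaj nmin → ℝ → Bool} (hA : MeasurableAlg nmaj nmin A) :
    ∑ j, ∫ x in Icc (0:ℝ) 1, tent K j x * (tentSample K nmaj nmin τ v).real {S | A S x ≠ v j} ≤
      excessRisk nmaj nmin A (covMeasure (hardPa τ) (tentEta K v))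
        (covMeasure (hardPb τ) (tentEta K v)) := by
  have hη := (continuous_tentEta v).measurable
  have hη1 := tentEta_mem v
  have hprob := isProbabilityMeasure_tentSample (nmaj := nmaj) (nmin := nmin) hτ v
  set Q := tentSample K nmaj nmin τ v with hQ
  set ν : Measure ℝ := volume.restrict (Icc (0:ℝ) 1) with hν
  have : IsProbabilityMeasure ν := ⟨by simp [hν]⟩
  let L : Bool → ℝ → ℝ := fun b x => if b then 1 - tentEta K v x else tentEta K v x
  let g : ℝ → Bool := fun x => decide (1/2 ≤ tentEta K v x)
  have hg : Measurable g := by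
    refine measurable_to_bool ?_
    have : g ⁻¹' {true} = {x | 1/2 ≤ tentEta K v x} := by ext; simp [g]
    rw [this]
    exact measurableSet_le measurable_const hη
  have hLb : ∀ b x, ‖L b x‖ ≤ 1 := fun b x => by
    have := hη1 x
    rw [Real.norm_eq_abs, abs_le]
    cases b <;> simp only [L] <;> constructor <;> norm_num <;> linarith
  have hAL : Integrable (fun z : Sample nmaj nmin × ℝ => L (A z.1 z.2) z.2) (Q.prod ν) := by
    refine Integrable.of_bound (C := 1) (Measurable.aestronglyMeasurable ?_)
      (Filter.Eventually.of_forall fun z => hLb _ _)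
    exact Measurable.ite (hA (measurableSet_singleton true))
      (measurable_const.sub (hη.comp measurable_snd)) (hη.comp measurable_snd)
  have hgL : Integrable (fun x => L (g x) x) ν :=
    Integrable.of_bound (C := 1) (Measurable.ite (hg (measurableSet_singleton true))
      (measurable_const.sub hη) hη).aestronglyMeasurable
      (Filter.Eventually.of_forall fun z => hLb _ _)
  have hind : ∀ j, Integrable (fun z : Sample nmaj nmin × ℝ =>
      tent K j z.2 * (if A z.1 z.2 ≠ v j then 1 else 0)) (Q.prod ν) := by
    intro j
    refine Integrable.of_bound (C := 1) (Measurable.aestronglyMeasurable ?_)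
      (Filter.Eventually.of_forall fun z => ?_)
    · exact ((continuous_tent j).measurable.comp measurable_snd).mul
        (Measurable.ite (hA (measurableSet_singleton (v j))).compl measurable_const
          measurable_const)
    · have h0 := tent_nonneg j z.2
      have h1 := tent_le_one j z.2
      rw [Real.norm_eq_abs, abs_le]
      split_ifs <;> constructor <;> linarith
  have hterm : ∀ j, ∫ z : Sample nmaj nmin × ℝ,
      tent K j z.2 * (if A z.1 z.2 ≠ v j then 1 else 0) ∂Q.prod ν =
        ∫ x, tent K j x * Q.real {S | A S x ≠ v j} ∂ν := by
    intro j
    rw [integral_prod_symm _ (hind j)]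
    refine integral_congr_ae (Filter.Eventually.of_forall fun x => ?_)
    have hset : MeasurableSet {S | A S x ≠ v j} :=
      (hA.comp measurable_prodMk_right (measurableSet_singleton (v j))).compl
    simp only
    rw [integral_const_mul, ← integral_indicator_one hset]
    congr 2
    ext S
    simp [indicator]
  have hrisk : ∀ f : ℝ → Bool, Measurable f →
      risk f (testMeasure (covMeasure (hardPa τ) (tentEta K v))
        (covMeasure (hardPb τ) (tentEta K v))) = ∫ x, L (f x) x ∂ν := by
    intro f hf
    rw [testMeasure_covMeasure measurable_hardPa measurable_hardPb hη (hardPa_nonneg hτ)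
      (hardPb_nonneg hτ) hη1 (fun x => by unfold hardPb; ring), risk_covMeasure_one hη hη1 hf]
  have hbayes := (bayesRisk_le_risk g _).trans_eq (hrisk g hg)
  calc ∑ j, ∫ x, tent K j x * Q.real {S | A S x ≠ v j} ∂ν
      = ∫ z : Sample nmaj nmin × ℝ,
          ∑ j, tent K j z.2 * (if A z.1 z.2 ≠ v j then 1 else 0) ∂Q.prod ν := by
        rw [integral_finsetSum _ fun j _ => hind j]
        exact Finset.sum_congr rfl fun j _ => (hterm j).symm
    _ ≤ ∫ z : Sample nmaj nmin × ℝ, (L (A z.1 z.2) z.2 - L (g z.2) z.2) ∂Q.prod ν :=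
        integral_mono (integrable_finsetSum _ fun j _ => hind j)
          (hAL.sub (hgL.comp_snd Q)) fun z => sum_tent_le_loss_sub v z.2 (A z.1 z.2)
    _ = (∫ S, ∫ x, L (A S x) x ∂ν ∂Q) - ∫ x, L (g x) x ∂ν := by
        rw [integral_sub hAL (hgL.comp_snd Q), integral_prod _ hAL,
          integral_fun_snd (fun x => L (g x) x), probReal_univ, one_smul]
    _ ≤ _ := by
        unfold excessRisk
        refine sub_le_sub (le_of_eq ?_) hbayes
        exact integral_congr_ae (Filter.Eventually.of_forall fun S =>
          (hrisk (A S) (hA.comp measurable_prodMk_left)).symm)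

lemma exp_le_sum_excessRisk (hτ : τ ∈ Icc (0:ℝ) 1) (hK : 0 < K)
    {A : Sample nmaj nmin → ℝ → Bool} (hA : MeasurableAlg nmaj nmin A) :
    2 ^ K * ((1/(64*(K:ℝ))) *
        Real.exp (-((nmin : ℝ)*(2-τ) + (nmaj : ℝ)*τ)/(3*(K:ℝ)^3))) ≤
      ∑ v : Fin K → Bool, excessRisk nmaj nmin A (covMeasure (hardPa τ) (tentEta K v))
        (covMeasure (hardPb τ) (tentEta K v)) := by
  set ρ := Real.exp (-((nmin : ℝ)*(2-τ) + (nmaj : ℝ)*τ)/(3*(K:ℝ)^3)) with hρ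
  have htent : ∀ j, Integrable (tent K j) (volume.restrict (Icc (0:ℝ) 1)) := fun j =>
    (continuous_tent j).continuousOn.integrableOn_compact isCompact_Icc
  have hint : ∀ (j : Fin K) (v : Fin K → Bool), Integrable
      (fun x => tent K j x * (tentSample K nmaj nmin τ v).real {S | A S x ≠ v j})
      (volume.restrict (Icc (0:ℝ) 1)) := by
    intro j v
    have := isProbabilityMeasure_tentSample (nmaj := nmaj) (nmin := nmin) hτ v
    refine (htent j).mul_bdd (c := 1) (Measurable.aestronglyMeasurable ?_)
      (Filter.Eventually.of_forall fun x => ?_)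
    · have hset : MeasurableSet {z : Sample nmaj nmin × ℝ | A z.1 z.2 ≠ v j} :=
        (hA (measurableSet_singleton (v j))).compl
      exact (measurable_measure_prodMk_right hset).ennreal_toReal
    · rw [Real.norm_eq_abs, abs_of_nonneg measureReal_nonneg]
      exact measureReal_le_one
  have hKpos : (0:ℝ) < K := by exact_mod_cast hK
  calc 2 ^ K * ((1/(64*(K:ℝ))) * ρ)
      = ∑ j : Fin K, ∫ x in Icc (0:ℝ) 1, tent K j x * (2 ^ K * ρ / 4) := by
        simp only [integral_mul_const, integral_tent, Finset.sum_const, Finset.card_univ,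
          Fintype.card_fin, nsmul_eq_mul]
        field_simp
        ring
    _ ≤ ∑ j : Fin K, ∫ x in Icc (0:ℝ) 1, ∑ v : Fin K → Bool,
          tent K j x * (tentSample K nmaj nmin τ v).real {S | A S x ≠ v j} := by
        refine Finset.sum_le_sum fun j _ => integral_mono ((htent j).mul_const _)
          (integrable_finsetSum _ fun v _ => hint j v) fun x => ?_
        simp only
        rw [← Finset.mul_sum]
        exact mul_le_mul_of_nonneg_left
          (exp_le_sum_error hτ j (hA.comp measurable_prodMk_right)) (tent_nonneg j x)
    _ = ∑ v : Fin K → Bool, ∑ j : Fin K, ∫ x in Icc (0:ℝ) 1,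
          tent K j x * (tentSample K nmaj nmin τ v).real {S | A S x ≠ v j} := by
        rw [Finset.sum_comm]
        exact Finset.sum_congr rfl fun j _ => integral_finsetSum _ fun v _ => hint j v
    _ ≤ _ := Finset.sum_le_sum fun v _ => sum_integral_le_excessRisk hτ v hA

end Excess

/-- **Lemma.** For any positive integer `K` and any `τ ∈ [0,1]`, the minimax excess risk
over the group-covariate shift class `𝒫_GS(τ)` is at least
`(1/(64K)) exp(-(n_min(2-τ) + n_maj τ)/(3K³))`. -/
theorem group_shift_lower_bound_anyK
    (K nmaj nmin : ℕ) (hK : 0 < K) (hmin : 1 ≤ nmin) (hmaj : nmin < nmaj)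
    (τ : ℝ) (hτ : τ ∈ Icc (0:ℝ) 1)
    (A : Sample nmaj nmin → ℝ → Bool) (hA : MeasurableAlg nmaj nmin A) :
    (1/(64*(K:ℝ))) *
        Real.exp (-((nmin : ℝ)*(2-τ) + (nmaj : ℝ)*τ)/(3*(K:ℝ)^3)) ≤
      ⨆ P : {P : Measure (ℝ × Bool) × Measure (ℝ × Bool) // memGS τ P.1 P.2},
        excessRisk nmaj nmin A P.1.1 P.1.2 := by
  have hbdd : BddAbove (range fun P : {P : Measure (ℝ × Bool) × Measure (ℝ × Bool) //
      memGS τ P.1 P.2} => excessRisk nmaj nmin A P.1.1 P.1.2) := by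
    refine ⟨1, ?_⟩
    rintro _ ⟨⟨⟨P, Q⟩, hPQ⟩, rfl⟩
    obtain ⟨_, _⟩ := isProbabilityMeasure_of_memGS hPQ
    exact excessRisk_le_one A P Q
  have hsum := (exp_le_sum_excessRisk hτ hK hA).trans
    (Finset.sum_le_card_nsmul Finset.univ _ _ fun v _ =>
      le_ciSup hbdd ⟨(covMeasure (hardPa τ) (tentEta K v), covMeasure (hardPb τ) (tentEta K v)),
        memGS_tentEta hτ v⟩)
  rw [Finset.card_univ, Fintype.card_fun, Fintype.card_bool, Fintype.card_fin, nsmul_eq_mul,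
    Nat.cast_pow, Nat.cast_ofNat] at hsum
  exact le_of_mul_le_mul_left hsum (by positivity)
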